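/- Assume G is weakly connected and 0 < u a − l a for every arc a, and let Γ : Matrix C A ℤ be an integral cycle basis matrix of G. Then the Lebesgue measure (MeasureTheory.volume on the space C → ℝ) of the cycle offset zonotope Z satisfies vol(Z) = ∑_{S ∈ 𝒮(G)} ∏_{a ∈ A \ S} (u a − l a) / T, the sum ranging over all spanning trees S of G and the product over all arcs not in S. In particular, the volume does not depend on the choice of the integral cycle basis. -/

import Mathlib

open Matrix MeasureTheory

/-- The undirected graph on `V` whose edges come from the arcs in `S`. -/
def edgeGraph {V A : Type*} (tail head : A → V) (S : Set A) : SimpleGraph V :=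
  SimpleGraph.fromRel (fun v w => ∃ a ∈ S, tail a = v ∧ head a = w)

/-- A spanning tree of the digraph, as a finite set of arcs. -/
def IsSpanningTree {V A : Type*} [Fintype V] (tail head : A → V) (S : Finset A) : Prop :=
  S.card = Fintype.card V - 1 ∧ (edgeGraph tail head (↑S : Set A)).Connected

open scoped Pointwise in
theorem Real.volume_add_segment {s : Set ℝ} (hs : Convex ℝ s) (hc : IsCompact s)
    (hne : s.Nonempty) : volume (s + Set.Icc (0 : ℝ) 1) = volume s + 1 := by
  have h := eq_Icc_of_connected_compact ⟨hne, hs.isPreconnected⟩ hc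
  have hle : sInf s ≤ sSup s := by
    rw [h] at hne
    exact Set.nonempty_Icc.1 hne
  have hadd : s + Set.Icc (0 : ℝ) 1 = Set.Icc (sInf s) (sSup s + 1) := by
    conv_lhs => rw [h]
    ext x
    simp only [Set.mem_add, Set.mem_Icc]
    constructor
    · rintro ⟨y, hy, z, hz, rfl⟩
      constructor <;> linarith
    · intro hx
      refine ⟨min x (sSup s), ⟨le_min hx.1 hle, min_le_right _ _⟩, x - min x (sSup s), ⟨?_, ?_⟩,
        by ring⟩
      · linarith [min_le_left x (sSup s)]
      · rcases min_choice x (sSup s) with h' | h' <;> rw [h'] <;> linarith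
  rw [hadd]
  conv_rhs => rw [h]
  rw [Real.volume_Icc, Real.volume_Icc, ← ENNReal.ofReal_one, ← ENNReal.ofReal_add (by linarith)
    zero_le_one]
  congr 1
  ring

open scoped Pointwise in
theorem MeasureTheory.prod_add_segment {E : Type*} [NormedAddCommGroup E] [NormedSpace ℝ E]
    [MeasurableSpace E] [BorelSpace E] [SecondCountableTopology E] (μ : Measure E) [SFinite μ]
    {K : Set (ℝ × E)} (hK : Convex ℝ K) (hc : IsCompact K) :
    (volume.prod μ) (K + segment ℝ 0 (1, 0)) = (volume.prod μ) K + μ (Prod.snd '' K) := by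
  have hseg : IsCompact (segment ℝ (0 : ℝ × E) (1, 0)) := by
    rw [segment_eq_image]
    exact isCompact_Icc.image (by fun_prop)
  have hfib (y : E) : volume ((fun x => (x, y)) ⁻¹' (K + segment ℝ 0 (1, 0))) =
      volume ((fun x => (x, y)) ⁻¹' K) + (Prod.snd '' K).indicator 1 y := by
    have hpre : (fun x => (x, y)) ⁻¹' (K + segment ℝ (0 : ℝ × E) (1, 0)) =
        (fun x : ℝ => (x, y)) ⁻¹' K + Set.Icc (0 : ℝ) 1 := by
      ext x
      simp only [segment_eq_image, Set.mem_preimage, Set.mem_add, Set.mem_image]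
      constructor
      · rintro ⟨⟨a, b⟩, hab, _, ⟨t, ht, rfl⟩, h⟩
        simp at h
        obtain ⟨rfl, rfl⟩ := h
        exact ⟨a, hab, t, ht, rfl⟩
      · rintro ⟨a, ha, t, ht, rfl⟩
        exact ⟨(a, y), ha, _, ⟨t, ht, rfl⟩, by simp⟩
    rw [hpre]
    by_cases hy : y ∈ Prod.snd '' K
    · rw [Set.indicator_of_mem hy, Pi.one_apply]
      have hconv : Convex ℝ ((fun x : ℝ => (x, y)) ⁻¹' K) := by
        intro a ha b hb s t hs ht hst
        have := hK ha hb hs ht hst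
        simpa [← add_smul, hst] using this
      refine Real.volume_add_segment hconv ?_ ?_
      · have hemb : Topology.IsClosedEmbedding (fun x : ℝ => (x, y)) :=
          .of_continuous_injective_isClosedMap (by fun_prop)
            (fun _ _ h => (Prod.mk.inj h).1) (isClosedMap_prodMk_right y)
        exact hemb.isCompact_preimage hc
      · obtain ⟨⟨a, b⟩, hab, rfl⟩ := hy
        exact ⟨a, hab⟩
    · have : (fun x : ℝ => (x, y)) ⁻¹' K = ∅ := by
        ext x
        simp only [Set.mem_preimage, Set.mem_empty_iff_false, iff_false]
        exact fun h => hy ⟨_, h, rfl⟩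
      simp [this, hy]
  have hm : MeasurableSet (Prod.snd '' K) := (hc.image continuous_snd).measurableSet
  rw [Measure.prod_apply_symm (hc.add hseg).measurableSet, Measure.prod_apply_symm hc.measurableSet]
  simp_rw [hfib]
  rw [lintegral_add_right _ (measurable_one.indicator hm), lintegral_indicator_one hm]

theorem LinearMap.image_segment_zero {E F : Type*} [AddCommGroup E] [Module ℝ E] [AddCommGroup F]
    [Module ℝ F] (f : E →ₗ[ℝ] F) (v : E) : f '' segment ℝ 0 v = segment ℝ 0 (f v) := by
  simpa using image_segment ℝ f.toAffineMap 0 v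

open scoped Pointwise in
theorem LinearMap.image_sum_segment_zero {ι E F : Type*} [AddCommGroup E] [Module ℝ E]
    [AddCommGroup F] [Module ℝ F] (f : E →ₗ[ℝ] F) (s : Finset ι) (g : ι → E) :
    f '' ∑ a ∈ s, segment ℝ 0 (g a) = ∑ a ∈ s, segment ℝ 0 (f (g a)) := by
  simp_rw [Set.image_finsetSum, LinearMap.image_segment_zero]

open scoped Pointwise in
theorem isCompact_sum_segment {ι E : Type*} [AddCommGroup E] [Module ℝ E] [TopologicalSpace E]
    [IsTopologicalAddGroup E] [ContinuousSMul ℝ E] (s : Finset ι) (g : ι → E) :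
    IsCompact (∑ a ∈ s, segment ℝ 0 (g a)) := by
  refine Finset.sum_induction _ IsCompact (fun _ _ => IsCompact.add) isCompact_singleton ?_
  intro a _
  rw [segment_eq_image]
  exact isCompact_Icc.image (by fun_prop)

open scoped Pointwise in
theorem MeasureTheory.volume_add_segment_single {n : ℕ} {K : Set (Fin (n + 1) → ℝ)}
    (hK : Convex ℝ K) (hc : IsCompact K) :
    volume (K + segment ℝ 0 (Pi.single 0 1)) =
      volume K + volume (LinearMap.funLeft ℝ ℝ Fin.succ '' K) := by
  let e := Fin.consLinearEquiv ℝ (fun _ : Fin (n + 1) => ℝ)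
  have hmp : MeasurePreserving e := by
    have := (volume_preserving_piFinSuccAbove (fun _ : Fin (n + 1) => ℝ) 0).symm
    convert this using 1
    ext x i
    simp [e, MeasurableEquiv.piFinSuccAbove]
  have hemb : MeasurableEmbedding e :=
    e.toContinuousLinearEquiv.toHomeomorph.measurableEmbedding
  have key := prod_add_segment (volume : Measure (Fin n → ℝ)) (K := e ⁻¹' K)
    (hK.linear_preimage e.toLinearMap)
    (e.toContinuousLinearEquiv.toHomeomorph.isClosedEmbedding.isCompact_preimage hc)
  have h1 : e ⁻¹' (K + segment ℝ 0 (Pi.single 0 1)) = e ⁻¹' K + segment ℝ 0 (1, 0) := by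
    have h := Set.image_add e (s := e ⁻¹' K) (t := segment ℝ 0 (1, 0))
    have he : e (1, 0) = Pi.single 0 1 := by
      ext i
      refine Fin.cases ?_ (fun i => ?_) i <;> simp [e]
    have hseg := LinearMap.image_segment_zero e.toLinearMap (1, 0)
    simp only [LinearEquiv.coe_coe, he] at hseg
    rw [Set.image_preimage_eq _ e.surjective, hseg] at h
    rw [← h, Set.preimage_image_eq _ e.injective]
  have h2 : LinearMap.funLeft ℝ ℝ Fin.succ '' K = Prod.snd '' (e ⁻¹' K) := by
    conv_lhs => rw [← Set.image_preimage_eq K e.surjective, Set.image_image]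
    congr 1
  rw [← hmp.measure_preimage_emb hemb, h1, ← hmp.measure_preimage_emb hemb, h2]
  exact key

/-- The absolute value of the maximal minor of the family `g` with index set `I`, expressed through
the Gram determinant so that no ordering of `I` has to be chosen. -/
noncomputable def absMinor {ι C : Type*} [Fintype C] [DecidableEq C] (g : ι → C → ℝ)
    (I : Finset ι) : ℝ :=
  √(∑ a ∈ I, vecMulVec (g a) (g a)).det

section absMinor

variable {ι C : Type*} [Fintype C] [DecidableEq C] (g : ι → C → ℝ)

theorem absMinor_eq_abs_det {I : Finset ι} (f : C → ι) (hf : Function.Injective f)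
    (hI : Set.range f = I) : absMinor g I = |(Matrix.of fun i j => g (f j) i).det| := by
  classical
  have hIm : I = Finset.univ.image f := by
    apply Finset.coe_injective
    simp [hI]
  have h : ∑ a ∈ I, vecMulVec (g a) (g a) =
      (Matrix.of fun i j => g (f j) i) * (Matrix.of fun i j => g (f j) i)ᵀ := by
    rw [hIm, Finset.sum_image hf.injOn]
    ext i j
    simp [Matrix.sum_apply, Matrix.mul_apply, vecMulVec_apply]
  rw [absMinor, h, det_mul, det_transpose, Real.sqrt_mul_self_eq_abs]

theorem absMinor_linearMap (L : (C → ℝ) →ₗ[ℝ] (C → ℝ)) (I : Finset ι) :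
    absMinor (fun a => L (g a)) I = |LinearMap.det L| * absMinor g I := by
  have h : ∑ a ∈ I, vecMulVec (L (g a)) (L (g a)) =
      LinearMap.toMatrix' L * (∑ a ∈ I, vecMulVec (g a) (g a)) * (LinearMap.toMatrix' L)ᵀ := by
    simp_rw [Matrix.mul_sum, Matrix.sum_mul, mul_vecMulVec, vecMulVec_mul, vecMul_transpose,
      LinearMap.toMatrix'_mulVec]
  rw [absMinor, h, det_mul, det_mul, det_transpose, LinearMap.det_toMatrix', mul_right_comm,
    Real.sqrt_mul (mul_self_nonneg _), Real.sqrt_mul_self_eq_abs, absMinor]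

theorem absMinor_reindex {D : Type*} [Fintype D] [DecidableEq D] (σ : D ≃ C) (I : Finset ι) :
    absMinor (fun a i => g a (σ i)) I = absMinor g I := by
  rw [absMinor, absMinor, ← det_submatrix_equiv_self σ]
  congr 2
  ext i j
  simp [Matrix.sum_apply, vecMulVec_apply]

theorem absMinor_nonneg (I : Finset ι) : 0 ≤ absMinor g I := Real.sqrt_nonneg _

end absMinor

theorem Finset.exists_fin_cons_range {ι : Type*} [DecidableEq ι] {n : ℕ} {I : Finset ι} {a : ι}
    (ha : a ∉ I) (hI : I.card = n) : ∃ f : Fin n → ι, Function.Injective f ∧ Set.range f = I ∧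
      Function.Injective (Fin.cons a f : Fin (n + 1) → ι) ∧
      Set.range (Fin.cons a f : Fin (n + 1) → ι) = insert a I := by
  have hr : Set.range (fun i => ((I.equivFinOfCardEq hI).symm i : ι)) = I := by
    rw [Set.range_comp' Subtype.val, Equiv.range_eq_univ]
    simp
  have hinj : Function.Injective (fun i => ((I.equivFinOfCardEq hI).symm i : ι)) :=
    Subtype.val_injective.comp (Equiv.injective _)
  refine ⟨_, hinj, hr, ?_, ?_⟩
  · rw [Fin.cons_injective_iff, hr]
    exact ⟨by simpa using ha, hinj⟩
  · rw [Fin.range_cons, hr, Finset.coe_insert]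

theorem absMinor_insert_of_eq_zero {ι : Type*} [DecidableEq ι] {n : ℕ} (g : ι → Fin (n + 1) → ℝ)
    {a : ι} (hga : g a = 0) {I : Finset ι} (ha : a ∉ I) (hI : I.card = n) :
    absMinor g (insert a I) = 0 := by
  obtain ⟨f, -, -, hf, hr⟩ := Finset.exists_fin_cons_range ha hI
  rw [absMinor_eq_abs_det g _ hf (by simpa using hr), abs_eq_zero]
  exact det_eq_zero_of_column_eq_zero 0 (by simp [hga])

theorem absMinor_insert_of_eq_single {ι : Type*} [DecidableEq ι] {n : ℕ} (g : ι → Fin (n + 1) → ℝ)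
    {a : ι} (hga : g a = Pi.single 0 1) {I : Finset ι} (ha : a ∉ I) (hI : I.card = n) :
    absMinor g (insert a I) = absMinor (fun b => LinearMap.funLeft ℝ ℝ Fin.succ (g b)) I := by
  obtain ⟨f, hf', hr', hf, hr⟩ := Finset.exists_fin_cons_range ha hI
  rw [absMinor_eq_abs_det g _ hf (by simpa using hr), absMinor_eq_abs_det _ f hf' hr',
    det_succ_column_zero, Fin.sum_univ_succ]
  simp [hga]
  rfl

open scoped Pointwise in
theorem volume_sum_segment_fin {ι : Type*} (s : Finset ι) : ∀ (n : ℕ) (g : ι → Fin n → ℝ),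
    volume (∑ a ∈ s, segment ℝ 0 (g a)) =
      ENNReal.ofReal (∑ I ∈ s.powersetCard n, absMinor g I) := by
  classical
  induction s using Finset.induction_on with
  | empty =>
    intro n g
    cases n with
    | zero =>
      have h : (0 : Set (Fin 0 → ℝ)) = Set.univ.pi fun _ => Set.univ := by
        ext x
        simp [Subsingleton.elim x 0]
      rw [Finset.sum_empty, h, volume_pi_pi]
      simp [absMinor]
    | succ n =>
      have h : Finset.powersetCard (n + 1) (∅ : Finset ι) = ∅ :=
        Finset.powersetCard_eq_empty.2 (by simp)
      simp [← Set.singleton_zero, h]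
  | insert a s ha ih =>
    intro n g
    rw [Finset.sum_insert ha]
    cases n with
    | zero =>
      have := ih 0 g
      rw [Subsingleton.elim (g a) 0, segment_same, Set.singleton_zero, zero_add, this]
      simp
    | succ n =>
      have hsplit (g : ι → Fin (n + 1) → ℝ) :
          ∑ I ∈ (insert a s).powersetCard (n + 1), absMinor g I =
          ∑ I ∈ s.powersetCard (n + 1), absMinor g I +
            ∑ I ∈ s.powersetCard n, absMinor g (insert a I) := by
        rw [Finset.powersetCard_succ_insert ha, Finset.sum_union, Finset.sum_image]
        · intro I hI J hJ h
          rw [Finset.mem_coe, Finset.mem_powersetCard] at hI hJ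
          rw [← Finset.erase_insert (fun h => ha (hI.1 h)), h,
            Finset.erase_insert (fun h => ha (hJ.1 h))]
        · rw [Finset.disjoint_left]
          intro I hI hI'
          obtain ⟨J, -, rfl⟩ := Finset.mem_image.1 hI'
          exact ha ((Finset.mem_powersetCard.1 hI).1 (Finset.mem_insert_self _ _))
      have hmem {I : Finset ι} (hI : I ∈ s.powersetCard n) : a ∉ I ∧ I.card = n :=
        ⟨fun h => ha ((Finset.mem_powersetCard.1 hI).1 h), (Finset.mem_powersetCard.1 hI).2⟩
      have hsingle (g : ι → Fin (n + 1) → ℝ) (hga : g a = Pi.single 0 1) :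
          volume (segment ℝ 0 (g a) + ∑ b ∈ s, segment ℝ 0 (g b)) =
            ENNReal.ofReal (∑ I ∈ (insert a s).powersetCard (n + 1), absMinor g I) := by
        rw [add_comm (segment ℝ 0 (g a)), hga, volume_add_segment_single
          (convex_sum _ fun _ _ => convex_segment _ _) (isCompact_sum_segment _ _),
          LinearMap.image_sum_segment_zero, ih, ih, hsplit, ENNReal.ofReal_add
          (Finset.sum_nonneg fun _ _ => absMinor_nonneg _ _)
          (Finset.sum_nonneg fun _ _ => absMinor_nonneg _ _)]
        congr 2
        exact Finset.sum_congr rfl fun I hI =>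
          (absMinor_insert_of_eq_single g hga (hmem hI).1 (hmem hI).2).symm
      by_cases hga : g a = 0
      · rw [hga, segment_same, Set.singleton_zero, zero_add, ih, hsplit,
          Finset.sum_eq_zero (s := s.powersetCard n), add_zero]
        exact fun I hI => absMinor_insert_of_eq_zero g hga (hmem hI).1 (hmem hI).2
      · obtain ⟨A, hA⟩ := SeparatingDual.exists_continuousLinearEquiv_apply_eq (R := ℝ) hga
          (Pi.single_ne_zero_iff.2 one_ne_zero : (Pi.single 0 1 : Fin (n + 1) → ℝ) ≠ 0)
        let L : (Fin (n + 1) → ℝ) →ₗ[ℝ] (Fin (n + 1) → ℝ) := A.toLinearEquiv.toLinearMap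
        have hdet : LinearMap.det L ≠ 0 := (LinearEquiv.isUnit_det' A.toLinearEquiv).ne_zero
        have h := hsingle (fun b => L (g b)) hA
        rw [← Finset.sum_insert ha (f := fun b => segment ℝ 0 (L (g b))),
          ← LinearMap.image_sum_segment_zero, Measure.addHaar_image_linearMap] at h
        simp_rw [absMinor_linearMap, ← Finset.mul_sum] at h
        rw [ENNReal.ofReal_mul (abs_nonneg _)] at h
        rw [← Finset.sum_insert ha (f := fun b => segment ℝ 0 (g b))]
        exact (ENNReal.mul_right_inj (by simpa using hdet) ENNReal.ofReal_ne_top).1 h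

open scoped Pointwise in
theorem volume_sum_segment {ι C : Type*} [Fintype C] [DecidableEq C] (s : Finset ι)
    (g : ι → C → ℝ) : volume (∑ a ∈ s, segment ℝ 0 (g a)) =
      ENNReal.ofReal (∑ I ∈ s.powersetCard (Fintype.card C), absMinor g I) := by
  let σ := (Fintype.equivFin C).symm
  have h := volume_sum_segment_fin s _ (fun a i => g a (σ i))
  simp_rw [absMinor_reindex] at h
  rw [← h, ← (volume_measurePreserving_piCongrLeft (fun _ : C => ℝ) σ).measure_preimage_equiv]
  congr 1
  rw [← MeasurableEquiv.image_symm]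
  exact LinearMap.image_sum_segment_zero (LinearMap.funLeft ℝ ℝ σ) s g

theorem LinearMap.finrank_range_add_finrank_ker_int {M N : Type*} [AddCommGroup M]
    [Module.Finite ℤ M] [AddCommGroup N] (f : M →ₗ[ℤ] N) :
    Module.finrank ℤ (LinearMap.range f) + Module.finrank ℤ (LinearMap.ker f) =
      Module.finrank ℤ M := by
  rw [← Submodule.finrank_quotient_add_finrank (LinearMap.ker f),
    f.quotKerEquivRange.finrank_eq]

theorem exists_vecMul_eq_of_mem_ker {V A C : Type*} [Fintype A] [Fintype C] {B : Matrix V A ℤ}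
    {Γ : Matrix C A ℤ}
    (hΓspan : Submodule.span ℤ (Set.range fun c : C => Γ c) = LinearMap.ker B.mulVecLin)
    {y : A → ℤ} (hy : B *ᵥ y = 0) : ∃ c : C → ℤ, c ᵥ* Γ = y := by
  have h : y ∈ LinearMap.ker B.mulVecLin := hy
  rw [← hΓspan, Submodule.mem_span_range_iff_exists_fun] at h
  obtain ⟨c, hc⟩ := h
  refine ⟨c, ?_⟩
  rw [← hc]
  ext a
  simp [vecMul, dotProduct, Finset.sum_apply]

section Incidence

variable {V A : Type*} [Fintype V] [DecidableEq V]
  {tail head : A → V} {B : Matrix V A ℤ}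

theorem sum_mul_incidence (hth : ∀ a, tail a ≠ head a)
    (hB : ∀ v a, B v a = if v = head a then 1 else if v = tail a then -1 else 0)
    (p : V → ℤ) (a : A) : ∑ v, p v * B v a = p (head a) - p (tail a) := by
  have h (v : V) : p v * B v a =
      (if v = head a then p v else 0) - (if v = tail a then p v else 0) := by
    rw [hB]
    split_ifs with h1 h2
    · exact absurd (h2.symm.trans h1) (hth a)
    all_goals simp
  simp [h]

variable [Fintype A]

theorem sum_mul_incidence_mulVec (hth : ∀ a, tail a ≠ head a)
    (hB : ∀ v a, B v a = if v = head a then 1 else if v = tail a then -1 else 0)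
    (p : V → ℤ) (y : A → ℤ) :
    ∑ v, p v * (B *ᵥ y) v = ∑ a, (p (head a) - p (tail a)) * y a := by
  simp_rw [← sum_mul_incidence hth hB p, mulVec, dotProduct, Finset.mul_sum, Finset.sum_mul,
    mul_assoc]
  exact Finset.sum_comm

theorem exists_incidence_mulVec_eq (hth : ∀ a, tail a ≠ head a)
    (hB : ∀ v a, B v a = if v = head a then 1 else if v = tail a then -1 else 0)
    {S : Set A} (hS : (edgeGraph tail head S).Connected) {q : V → ℤ} (hq : ∑ v, q v = 0) :
    ∃ y : A → ℤ, (∀ a ∉ S, y a = 0) ∧ B *ᵥ y = q := by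
  classical
  let P : Submodule ℤ (A → ℤ) :=
    { carrier := {y | ∀ a ∉ S, y a = 0}
      add_mem' := fun hx hy a ha => by simp [hx a ha, hy a ha]
      zero_mem' := fun a _ => rfl
      smul_mem' := fun c x hx a ha => by simp [hx a ha] }
  have harc (a : A) (ha : a ∈ S) :
      Pi.single (head a) 1 - Pi.single (tail a) 1 ∈ P.map B.mulVecLin := by
    refine ⟨Pi.single a 1, fun b hb => Pi.single_eq_of_ne (by rintro rfl; exact hb ha) _, ?_⟩
    ext v
    have := hth a
    simp only [mulVecLin_apply, mulVec_single_one, col_apply, hB, Pi.sub_apply, Pi.single_apply]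
    split_ifs with h1 h2
    · exact absurd (h2.symm.trans h1) this
    all_goals simp
  have hpair (v w : V) : Pi.single w 1 - Pi.single v 1 ∈ P.map B.mulVecLin := by
    have h := (SimpleGraph.reachable_iff_reflTransGen v w).1 (hS.preconnected v w)
    induction h with
    | refl => simp
    | @tail b c _ hbc ih =>
      have hstep : Pi.single c 1 - Pi.single b 1 ∈ P.map B.mulVecLin := by
        rw [edgeGraph, SimpleGraph.fromRel_adj] at hbc
        rcases hbc.2 with ⟨a, ha, rfl, rfl⟩ | ⟨a, ha, rfl, rfl⟩
        · exact harc a ha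
        · rw [← neg_sub]
          exact neg_mem (harc a ha)
      simpa using add_mem hstep ih
  obtain ⟨v₀⟩ := hS.nonempty
  have hmem : q ∈ P.map B.mulVecLin := by
    have h : q = ∑ v, q v • (Pi.single v 1 - Pi.single v₀ 1 : V → ℤ) := by
      simp_rw [smul_sub, Finset.sum_sub_distrib, ← Finset.sum_smul, hq, zero_smul, sub_zero]
      ext w
      simp [Finset.sum_apply, Pi.single_apply]
    rw [h]
    exact sum_mem fun v _ => Submodule.smul_mem _ _ (hpair v₀ v)
  obtain ⟨y, hy, hyq⟩ := hmem
  exact ⟨y, hy, hyq⟩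

theorem finrank_ker_incidence (hth : ∀ a, tail a ≠ head a)
    (hB : ∀ v a, B v a = if v = head a then 1 else if v = tail a then -1 else 0)
    (hconn : (edgeGraph tail head (Set.univ : Set A)).Connected) :
    Module.finrank ℤ (LinearMap.ker B.mulVecLin) + Fintype.card V = Fintype.card A + 1 := by
  let σ : (V → ℤ) →ₗ[ℤ] ℤ := Fintype.linearCombination ℤ (fun _ => (1 : ℤ))
  have hσ (q : V → ℤ) : σ q = ∑ v, q v := by simp [σ, Fintype.linearCombination_apply]
  have hrange : LinearMap.range B.mulVecLin = LinearMap.ker σ := by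
    ext q
    rw [LinearMap.mem_ker, hσ]
    constructor
    · rintro ⟨y, rfl⟩
      simpa using sum_mul_incidence_mulVec hth hB 1 y
    · intro hq
      obtain ⟨y, -, hy⟩ := exists_incidence_mulVec_eq hth hB hconn hq
      exact ⟨y, hy⟩
  have hsurj : LinearMap.range σ = ⊤ := by
    obtain ⟨v₀⟩ := hconn.nonempty
    exact LinearMap.range_eq_top.2 fun z => ⟨Pi.single v₀ z, by simp [hσ]⟩
  have h1 := LinearMap.finrank_range_add_finrank_ker_int B.mulVecLin
  have h2 := LinearMap.finrank_range_add_finrank_ker_int σ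
  rw [hsurj, finrank_top, Module.finrank_self, Module.finrank_fintype_fun_eq_card] at h2
  rw [hrange, Module.finrank_fintype_fun_eq_card] at h1
  omega

variable {C : Type*} [Fintype C] {Γ : Matrix C A ℤ}

theorem isUnit_det_submatrix_of_connected [DecidableEq A] [DecidableEq C]
    (hth : ∀ a, tail a ≠ head a)
    (hB : ∀ v a, B v a = if v = head a then 1 else if v = tail a then -1 else 0)
    (hΓspan : Submodule.span ℤ (Set.range fun c : C => Γ c) = LinearMap.ker B.mulVecLin)
    {S : Set A} (hS : (edgeGraph tail head S).Connected) {f : C → A}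
    (hf : Function.Injective f) (hfS : ∀ c, f c ∉ S) :
    IsUnit (Γ.submatrix id f).det := by
  have hrow (c₀ : C) : ∃ c : C → ℤ, c ᵥ* Γ.submatrix id f = Pi.single c₀ 1 := by
    have hsum : ∑ v, (B *ᵥ Pi.single (f c₀) 1) v = 0 := by
      simpa using sum_mul_incidence_mulVec hth hB 1 (Pi.single (f c₀) 1)
    obtain ⟨y, hyS, hy⟩ := exists_incidence_mulVec_eq hth hB hS hsum
    obtain ⟨c, hc⟩ := exists_vecMul_eq_of_mem_ker hΓspan
      (y := Pi.single (f c₀) 1 - y) (by rw [mulVec_sub, hy, sub_self])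
    refine ⟨c, ?_⟩
    ext d
    have := congrFun hc (f d)
    rw [Pi.sub_apply, hyS _ (hfS d), sub_zero] at this
    refine this.trans ?_
    simp [Pi.single_apply, hf.eq_iff]
  choose N hN using hrow
  refine isUnit_det_of_left_inverse (B := Matrix.of N) ?_
  ext i j
  refine (congrFun (hN i) j).trans ?_
  rw [Pi.single_apply, one_apply]
  exact if_congr eq_comm rfl rfl

theorem det_submatrix_eq_zero_of_not_connected [DecidableEq A] [DecidableEq C] [Nonempty V]
    (hth : ∀ a, tail a ≠ head a)
    (hB : ∀ v a, B v a = if v = head a then 1 else if v = tail a then -1 else 0)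
    (hΓspan : Submodule.span ℤ (Set.range fun c : C => Γ c) = LinearMap.ker B.mulVecLin)
    {S : Finset A} (hcard : S.card = Fintype.card V - 1)
    (hS : ¬ (edgeGraph tail head (S : Set A)).Connected) {f : C → A} (hfS : ∀ c, f c ∉ S) :
    (Γ.submatrix id f).det = 0 := by
  classical
  obtain ⟨x₀, x₁, hx⟩ : ∃ x₀ x₁, ¬ (edgeGraph tail head (S : Set A)).Reachable x₀ x₁ := by
    by_contra! h
    exact hS ⟨h⟩
  have hne : x₀ ≠ x₁ := fun h => hx (h ▸ SimpleGraph.Reachable.refl _)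
  let W := {v : V // v ∈ ({x₀, x₁} : Finset V)ᶜ}
  let M : Matrix W S ℤ := B.submatrix Subtype.val Subtype.val
  have hcardW : Fintype.card W = Fintype.card V - 2 := by
    rw [Fintype.card_coe, Finset.card_compl, Finset.card_pair hne]
  have hVcard : 2 ≤ Fintype.card V := by
    rw [← Finset.card_pair hne]
    exact Finset.card_le_univ _
  obtain ⟨z, hz, hz0⟩ : ∃ z : S → ℤ, M *ᵥ z = 0 ∧ z ≠ 0 := by
    by_contra! h
    have hinj : Function.Injective M.mulVecLin :=
      (injective_iff_map_eq_zero _).2 fun z hz => h z hz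
    have := card_le_of_injective ℤ M.mulVecLin hinj
    rw [Fintype.card_coe, hcardW] at this
    omega
  let y : A → ℤ := fun a => if h : a ∈ S then z ⟨a, h⟩ else 0
  have hyS (a : A) (ha : a ∉ S) : y a = 0 := dif_neg ha
  have hyz (a : S) : y a = z a := dif_pos a.2
  have hBy (v : V) (h0 : v ≠ x₀) (h1 : v ≠ x₁) : (B *ᵥ y) v = 0 := by
    have h := congrFun hz ⟨v, by simp [h0, h1]⟩
    rw [Pi.zero_apply] at h
    rw [← h, mulVec, dotProduct, mulVec, dotProduct,
      ← Finset.sum_subset (Finset.subset_univ S) fun a _ ha => by rw [hyS a ha, mul_zero],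
      ← Finset.sum_coe_sort]
    exact Finset.sum_congr rfl fun a _ => by rw [hyz]; rfl
  have hsum (p : V → ℤ) (hp : ∀ a ∈ S, p (head a) = p (tail a)) :
      p x₀ * (B *ᵥ y) x₀ + p x₁ * (B *ᵥ y) x₁ = 0 := by
    rw [← Finset.sum_pair (f := fun v => p v * (B *ᵥ y) v) hne,
      Finset.sum_subset (Finset.subset_univ _), sum_mul_incidence_mulVec hth hB]
    · refine Finset.sum_eq_zero fun a _ => ?_
      by_cases ha : a ∈ S
      · rw [hp a ha, sub_self, zero_mul]
      · rw [hyS a ha, mul_zero]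
    · intro v _ hv
      simp only [Finset.mem_insert, Finset.mem_singleton, not_or] at hv
      rw [hBy v hv.1 hv.2, mul_zero]
  have hadj (a : A) (ha : a ∈ S) : (edgeGraph tail head (S : Set A)).Adj (tail a) (head a) := by
    rw [edgeGraph, SimpleGraph.fromRel_adj]
    exact ⟨hth a, .inl ⟨a, ha, rfl, rfl⟩⟩
  have h0 := hsum (fun v => if (edgeGraph tail head (S : Set A)).Reachable x₀ v then 1 else 0)
    fun a ha => if_congr ⟨fun h => h.trans (hadj a ha).symm.reachable,
      fun h => h.trans (hadj a ha).reachable⟩ rfl rfl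
  have h1 := hsum 1 fun _ _ => rfl
  simp [hx] at h0
  simp [h0] at h1
  have hker : B *ᵥ y = 0 := by
    ext v
    by_cases hv0 : v = x₀
    · rw [hv0, h0, Pi.zero_apply]
    by_cases hv1 : v = x₁
    · rw [hv1, h1, Pi.zero_apply]
    exact hBy v hv0 hv1
  obtain ⟨c, hc⟩ := exists_vecMul_eq_of_mem_ker hΓspan hker
  refine exists_vecMul_eq_zero_iff.1 ⟨c, ?_, ?_⟩
  · rintro rfl
    rw [zero_vecMul] at hc
    exact hz0 (funext fun a => by rw [← hyz, ← hc]; rfl)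
  · ext d
    exact (congrFun hc (f d)).trans (hyS _ (hfS d))

end Incidence

theorem absMinor_scaled_cycle_basis {V A C : Type*} [Fintype V] [Fintype A] [Fintype C]
    [DecidableEq V] [DecidableEq A] [DecidableEq C] [Nonempty V] {tail head : A → V}
    (hth : ∀ a, tail a ≠ head a) {B : Matrix V A ℤ}
    (hB : ∀ v a, B v a = if v = head a then 1 else if v = tail a then -1 else 0)
    {Γ : Matrix C A ℤ}
    (hΓspan : Submodule.span ℤ (Set.range fun c : C => Γ c) = LinearMap.ker B.mulVecLin)
    {w : A → ℝ} (hw : ∀ a, 0 ≤ w a) {I : Finset A} (hI : I.card = Fintype.card C)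
    (hIc : Iᶜ.card = Fintype.card V - 1) [Decidable (IsSpanningTree tail head Iᶜ)] :
    absMinor (fun a c => w a * (Γ c a : ℝ)) I =
      if IsSpanningTree tail head Iᶜ then ∏ a ∈ I, w a else 0 := by
  let e : C ≃ I := Fintype.equivOfCardEq (by rw [Fintype.card_coe, hI])
  let f : C → A := fun c => e c
  have hf : Function.Injective f := Subtype.val_injective.comp e.injective
  have hr : Set.range f = I := by
    rw [Set.range_comp' Subtype.val, Equiv.range_eq_univ]
    simp
  have hfI (c : C) : f c ∉ Iᶜ := by simp [f]
  have hprod : ∏ c, w (f c) = ∏ a ∈ I, w a := by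
    rw [← Finset.prod_coe_sort I]
    exact e.prod_comp fun a => w a
  have hdet : (Matrix.of fun i j => w (f j) * (Γ i (f j) : ℝ)).det =
      (∏ a ∈ I, w a) * ((Γ.submatrix id f).det : ℝ) := by
    rw [← hprod, Int.cast_det]
    exact det_mul_row (fun c => w (f c)) _
  rw [absMinor_eq_abs_det _ f hf hr, hdet, abs_mul,
    abs_of_nonneg (Finset.prod_nonneg fun a _ => hw a)]
  split_ifs with h
  · have := isUnit_det_submatrix_of_connected hth hB hΓspan h.2 hf hfI
    rw [← Int.cast_abs, Int.isUnit_iff_abs_eq.1 this, Int.cast_one, mul_one]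
  · rw [det_submatrix_eq_zero_of_not_connected hth hB hΓspan hIc (fun hc => h ⟨hIc, hc⟩) hfI]
    simp

theorem volume_cycle_offset_zonotope
    {V A C : Type*} [Fintype V] [Fintype A] [Fintype C]
    [DecidableEq V] [DecidableEq A]
    (tail head : A → V) (hth : ∀ a, tail a ≠ head a)
    (T : ℝ) (hT : 0 < T) (l u : A → ℝ) (hlu : ∀ a, l a ≤ u a)
    (hconn : (edgeGraph tail head (Set.univ : Set A)).Connected)
    (hspan : ∀ a, 0 < u a - l a)
    (B : Matrix V A ℤ)
    (hB : ∀ v a, B v a = if v = head a then 1 else if v = tail a then -1 else 0)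
    (Γ : Matrix C A ℤ)
    (hΓentries : ∀ c a, Γ c a = -1 ∨ Γ c a = 0 ∨ Γ c a = 1)
    (hΓindep : LinearIndependent ℤ (fun c : C => Γ c))
    (hΓspan : Submodule.span ℤ (Set.range fun c : C => Γ c)
      = LinearMap.ker B.mulVecLin) :
    volume {z : C → ℝ | ∃ x : A → ℝ, (∀ a, l a ≤ x a ∧ x a ≤ u a) ∧
        (Γ.map (Int.cast : ℤ → ℝ)).mulVec x = T • z}
      = ENNReal.ofReal
          (∑ᶠ S ∈ {S : Finset A | IsSpanningTree tail head S},
            ∏ a ∈ Sᶜ, (u a - l a) / T) := by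
  classical
  have hV : Nonempty V := hconn.nonempty
  have hcard : Fintype.card C + Fintype.card V = Fintype.card A + 1 := by
    rw [← finrank_ker_incidence hth hB hconn, ← hΓspan, finrank_span_eq_card hΓindep]
  have hVpos : 0 < Fintype.card V := Fintype.card_pos
  let w : A → ℝ := fun a => (u a - l a) / T
  have hw (a : A) : 0 < w a := div_pos (hspan a) hT
  let g : A → C → ℝ := fun a c => w a * (Γ c a : ℝ)
  have hZ : (fun z => T⁻¹ • (Γ.map (Int.cast : ℤ → ℝ)) *ᵥ l + z) ⁻¹'
      {z : C → ℝ | ∃ x : A → ℝ, (∀ a, l a ≤ x a ∧ x a ≤ u a) ∧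
        (Γ.map (Int.cast : ℤ → ℝ)).mulVec x = T • z} = parallelepiped g := by
    ext z
    simp only [Set.mem_preimage, Set.mem_ofPred_eq, mem_parallelepiped_iff]
    have hlin (t : A → ℝ) : T • ∑ a, t a • g a =
        (Γ.map (Int.cast : ℤ → ℝ)) *ᵥ fun a => t a * (u a - l a) := by
      ext c
      simp only [Pi.smul_apply, Finset.sum_apply, smul_eq_mul, Finset.mul_sum, mulVec, dotProduct,
        map_apply, g, w]
      refine Finset.sum_congr rfl fun a _ => ?_
      field_simp
    rw [smul_add, smul_inv_smul₀ hT.ne']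
    constructor
    · rintro ⟨x, hx, hxz⟩
      refine ⟨fun a => (x a - l a) / (u a - l a), ⟨fun a => ?_, fun a => ?_⟩, ?_⟩
      · exact div_nonneg (sub_nonneg.2 (hx a).1) (hspan a).le
      · exact div_le_one_of_le₀ (by linarith [hx a]) (hspan a).le
      · apply smul_right_injective _ hT.ne'
        change T • z = T • _
        rw [hlin, ← sub_eq_iff_eq_add'.2 hxz, ← mulVec_sub]
        congr 1
        ext a
        exact (div_mul_cancel₀ _ (hspan a).ne').symm
    · rintro ⟨t, ht, rfl⟩
      refine ⟨fun a => l a + t a * (u a - l a), fun a => ⟨?_, ?_⟩, ?_⟩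
      · linarith [mul_nonneg (ht.1 a) (hspan a).le]
      · have := mul_le_of_le_one_left (hspan a).le (ht.2 a)
        change l a + t a * (u a - l a) ≤ u a
        linarith
      · rw [hlin, ← mulVec_add]
        rfl
  rw [← measure_preimage_add volume (T⁻¹ • (Γ.map (Int.cast : ℤ → ℝ)) *ᵥ l), hZ,
    parallelepiped_eq_sum_segment, volume_sum_segment]
  congr 1
  have hterm (I : Finset A) (hI : I ∈ Finset.univ.powersetCard (Fintype.card C)) :
      absMinor g I = if IsSpanningTree tail head Iᶜ then ∏ a ∈ I, w a else 0 := by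
    have hIcard := (Finset.mem_powersetCard.1 hI).2
    refine absMinor_scaled_cycle_basis hth hB hΓspan (fun a => (hw a).le) hIcard ?_
    rw [Finset.card_compl]
    omega
  have hfin : {S : Finset A | IsSpanningTree tail head S} =
      ↑(Finset.univ.filter fun S : Finset A => IsSpanningTree tail head S) := by
    ext S
    simp
  rw [Finset.sum_congr rfl hterm, ← Finset.sum_filter, hfin, finsum_mem_coe_finset]
  refine Finset.sum_nbij' compl compl ?_ ?_ ?_ ?_ ?_
  · intro I hI
    simpa using (Finset.mem_filter.1 hI).2
  · intro S hS
    have hS' := (Finset.mem_filter.1 hS).2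
    rw [Finset.mem_filter, Finset.mem_powersetCard, Finset.card_compl, compl_compl, hS'.1]
    exact ⟨⟨Finset.subset_univ _, by omega⟩, hS'⟩
  · exact fun I _ => compl_compl I
  · exact fun S _ => compl_compl S
  · intro I _
    rw [compl_compl]
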